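/- arXiv:2010.01678 — 3 statements merged into one kernel-verified Lean document; each statement's English description precedes it below -/
import Mathlib

section
/- Consider best-first search over partial programs: a worklist (finite multiset) of partial programs each carrying a priority, initialized with the root partial program S₀ with priority 1; at each step the element P with maximum priority is removed; if P has no completion satisfying the specification φ it may be discarded; if P is complete and satisfies φ it is returned; otherwise, for each grammar production r applicable to a chosen nonterminal leaf l of P, the expansion Expand(P, l, r) is added to the worklist with priority u(Expand(P, l, r)). Assume the priority function u satisfies: (i) admissibility — for every partial program P and every complete program P* obtainable from P by a finite sequence of expansions, the model score M(P*) ≤ u(P); and (ii) u(P) = M(P) whenever P is complete. Then if this search returns a complete program P*, every complete program P that is derivable from S₀ and satisfies φ has M(P) ≤ M(P*). -/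
/-!
STATEMENT 0: Best-first search over partial programs (worklist of partial programs with
priorities, initialized with `{(S₀, 1)}`).  At each step the element of maximum priority is
removed; it may be discarded if it has no completion satisfying the specification; if it is
complete and satisfies the specification it is returned; otherwise, for a chosen nonterminal
leaf, all its one-step expansions (one per applicable production) are enqueued, each with
priority `u` of the expansion.  Partial programs are abstracted as a type `α` with a one-step
expansion relation `expand`; "complete program obtainable from `P` by a finite sequence of
expansions" is `Relation.ReflTransGen expand P P' ∧ complete P'`.  The fact that *all*
applicable productions for the chosen leaf are enqueued is captured by the covering condition
`hcover`: every complete program derivable from `P` is derivable from one of the enqueued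
expansions.  Complete programs have no nonterminal leaves, hence no expansions.
-/

/-- One step of the best-first search.  The worklist is a finite multiset of
(partial program, priority) pairs. -/
inductive BFSStep {α : Type*} (expand : α → α → Prop) (complete sat : α → Prop) (u : α → ℝ) :
    Multiset (α × ℝ) → Multiset (α × ℝ) → Prop
  /-- Discard a maximal-priority element having no completion that satisfies the
  specification. -/
  | discard (P : α) (ρ : ℝ) (Q : Multiset (α × ℝ))
      (hmax : ∀ q ∈ (P, ρ) ::ₘ Q, q.2 ≤ ρ)
      (hinf : ∀ P', Relation.ReflTransGen expand P P' → complete P' → ¬ sat P') :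
      BFSStep expand complete sat u ((P, ρ) ::ₘ Q) Q
  /-- Expand a maximal-priority incomplete element: enqueue a multiset `S` of one-step
  expansions of `P` (the expansions of the chosen leaf by every applicable production, so
  every complete program derivable from `P` is derivable from some member of `S`), each with
  priority given by `u`. -/
  | expand (P : α) (ρ : ℝ) (Q : Multiset (α × ℝ)) (S : Multiset α)
      (hmax : ∀ q ∈ (P, ρ) ::ₘ Q, q.2 ≤ ρ)
      (hnc : ¬ complete P)
      (hexp : ∀ P' ∈ S, expand P P')
      (hcover : ∀ P', complete P' → Relation.ReflTransGen expand P P' →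
          ∃ P'' ∈ S, Relation.ReflTransGen expand P'' P') :
      BFSStep expand complete sat u ((P, ρ) ::ₘ Q) (Q + S.map fun P' => (P', u P'))

/-- If the best-first search, started from the worklist `{(S₀, 1)}`, returns a complete
program `P*` satisfying the specification (i.e. reaches a state in which a maximal-priority
element `P*` is complete and satisfies the specification), then — assuming the priority
function `u` is admissible (`M P' ≤ u P` for every completion `P'` of `P`) and agrees with
the model score `M` on complete programs — every complete program derivable from `S₀` that
satisfies the specification has model score at most `M P*`. -/
theorem bfs_returns_optimal {α : Type*} (expand : α → α → Prop) (complete sat : α → Prop)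
    (M u : α → ℝ) (S₀ : α)
    (hM_nonneg : ∀ P, 0 ≤ M P)
    (hcomplete_no_expand : ∀ P P', complete P → ¬ expand P P')
    (hadm : ∀ P P', Relation.ReflTransGen expand P P' → complete P' → M P' ≤ u P)
    (hu_complete : ∀ P, complete P → u P = M P)
    (Pstar : α) (ρstar : ℝ) (Q : Multiset (α × ℝ))
    (hreach : Relation.ReflTransGen (BFSStep expand complete sat u)
      {(S₀, (1 : ℝ))} ((Pstar, ρstar) ::ₘ Q))
    (hmax : ∀ q ∈ (Pstar, ρstar) ::ₘ Q, q.2 ≤ ρstar)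
    (hc : complete Pstar) (hsat : sat Pstar) :
    ∀ P, Relation.ReflTransGen expand S₀ P → complete P → sat P → M P ≤ M Pstar := by
  intro P hSP hcP hsP
  have key : ∀ W, Relation.ReflTransGen (BFSStep expand complete sat u) {(S₀, (1 : ℝ))} W →
      (W = {(S₀, (1 : ℝ))} ∨ ∀ q ∈ W, q.2 = u q.1) ∧
      ∃ q ∈ W, Relation.ReflTransGen expand q.1 P := by
    intro W hW
    induction hW with
    | refl => exact ⟨Or.inl rfl, (S₀, 1), by simp, hSP⟩
    | tail _ hstep ih =>
      obtain ⟨ih1, q, hq, hqP⟩ := ih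
      cases hstep with
      | discard P₀ ρ Q' hmax' hinf =>
        refine ⟨?_, ?_⟩
        · rcases ih1 with h | h
          · right
            have h2 := congrArg Multiset.card h
            simp at h2
            simp [h2]
          · exact Or.inr fun q hq => h q (Multiset.mem_cons_of_mem hq)
        · rcases Multiset.mem_cons.1 hq with rfl | hq
          · exact absurd hsP (hinf P hqP hcP)
          · exact ⟨q, hq, hqP⟩
      | expand P₀ ρ Q' S hmax' hnc hexp hcover =>
        refine ⟨Or.inr ?_, ?_⟩
        · intro q hq
          rcases Multiset.mem_add.1 hq with hq | hq
          · rcases ih1 with h | h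
            · have h2 := congrArg Multiset.card h
              simp at h2
              simp [h2] at hq
            · exact h q (Multiset.mem_cons_of_mem hq)
          · obtain ⟨x, _, rfl⟩ := Multiset.mem_map.1 hq
            rfl
        · rcases Multiset.mem_cons.1 hq with rfl | hq
          · obtain ⟨x, hx, hxP⟩ := hcover P hcP hqP
            exact ⟨(x, u x), Multiset.mem_add.2 (Or.inr (Multiset.mem_map.2 ⟨x, hx, rfl⟩)), hxP⟩
          · exact ⟨q, Multiset.mem_add.2 (Or.inl hq), hqP⟩
  obtain ⟨h1, q, hq, hqP⟩ := key _ hreach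
  rcases h1 with h | h
  · have hm : (Pstar, ρstar) ∈ ({(S₀, (1 : ℝ))} : Multiset (α × ℝ)) :=
      h ▸ Multiset.mem_cons_self _ _
    have he : Pstar = S₀ := congrArg Prod.fst (Multiset.mem_singleton.1 hm)
    subst he
    rcases Relation.ReflTransGen.cases_head hSP with h3 | ⟨c, h3, _⟩
    · rw [h3]
    · exact absurd h3 (hcomplete_no_expand _ _ hc)
  · have a := hadm _ _ hqP hcP
    have b := h q hq
    have c := hmax q hq
    have d : ρstar = u Pstar := h _ (Multiset.mem_cons_self _ _)
    have e := hu_complete _ hc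
    linarith
end

section
/- Let C be a one-hole regular-expression context over an alphabet α (built from 0, 1, char a, plus, comp, star, and a single hole), and let ⊤ be any regular expression over α whose matched language is the set of all words (for example, the star of the sum of all characters when α is a nonempty fintype). If a word s is not matched by C[⊤], then for every regular expression r over α, s is not matched by C[r]. Hence a partial regular expression whose over-approximation (hole replaced by ⊤) fails to match a given positive example has no completion matching that example. -/
/-!
STATEMENT 7: Over-approximation soundness for pruning with positive examples.  For a one-hole
regular-expression context `C` and a regular expression `⊤` whose matched language is the set
of all words, if a word `s` is not matched by `C.fill ⊤` then, for every regular
expression `r`, `s` is not matched by `C.fill r`.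
-/

/-- One-hole contexts for regular expressions. -/
inductive RegexContext (α : Type*) where
  | hole : RegexContext α
  | plusLeft : RegexContext α → RegularExpression α → RegexContext α
  | plusRight : RegularExpression α → RegexContext α → RegexContext α
  | compLeft : RegexContext α → RegularExpression α → RegexContext α
  | compRight : RegularExpression α → RegexContext α → RegexContext α
  | star : RegexContext α → RegexContext α

/-- Substitute the regular expression `r` for the hole of the context `C`. -/
def RegexContext.fill {α : Type*} : RegexContext α → RegularExpression α → RegularExpression α
  | .hole, r => r
  | .plusLeft C e, r => C.fill r + e
  | .plusRight e C, r => e + C.fill r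
  | .compLeft C e, r => (C.fill r) * e
  | .compRight e C, r => e * C.fill r
  | .star C, r => (C.fill r).star

theorem RegexContext.fill_mono_aux {α : Type*} (C : RegexContext α)
    (top : RegularExpression α) (htop : ∀ w : List α, w ∈ top.matches')
    (r : RegularExpression α) : ∀ s, s ∈ (C.fill r).matches' → s ∈ (C.fill top).matches' := by
  induction C with
  | hole => intro s _; exact htop s
  | plusLeft C e ih =>
    intro s h
    rw [RegexContext.fill, RegularExpression.matches'_add, Language.mem_add] at h ⊢
    exact h.imp (ih s) id
  | plusRight e C ih =>
    intro s h
    rw [RegexContext.fill, RegularExpression.matches'_add, Language.mem_add] at h ⊢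
    exact h.imp id (ih s)
  | compLeft C e ih =>
    intro s h
    rw [RegexContext.fill, RegularExpression.matches'_mul, Language.mem_mul] at h ⊢
    obtain ⟨a, ha, b, hb, rfl⟩ := h
    exact ⟨a, ih a ha, b, hb, rfl⟩
  | compRight e C ih =>
    intro s h
    rw [RegexContext.fill, RegularExpression.matches'_mul, Language.mem_mul] at h ⊢
    obtain ⟨a, ha, b, hb, rfl⟩ := h
    exact ⟨a, ha, b, ih b hb, rfl⟩
  | star C ih =>
    intro s h
    rw [RegexContext.fill, RegularExpression.matches'_star, Language.mem_kstar] at h ⊢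
    obtain ⟨L, rfl, hL⟩ := h
    exact ⟨L, rfl, fun y hy => ih y (hL y hy)⟩

theorem over_approximation_prunes {α : Type*} (C : RegexContext α)
    (top : RegularExpression α) (htop : ∀ w : List α, w ∈ top.matches')
    (s : List α) (hs : s ∉ (C.fill top).matches') :
    ∀ r : RegularExpression α, s ∉ (C.fill r).matches' := by
  exact fun r h => hs (C.fill_mono_aux top htop r s h)
end

section
/- Consider best-first search over partial programs with a priority function u and model score M on complete programs, satisfying: (i) for every partial program P and every completion P* of P, M(P*) ≤ u(P); (ii) u(P) = M(P) for complete P; and (iii) whenever P is expanded, each expansion P' inserted into the worklist satisfies u(P') ≤ u(P). Then in any execution of the search starting from the root with its priority, the complete programs are dequeued from the worklist in non-increasing order of their model scores M; consequently, the first dequeued complete program satisfying the specification φ has maximal score M among all complete programs satisfying φ that are ever dequeued. -/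
/-!
STATEMENT 9: Best-first search over partial programs (a type `α` with one-step expansion
relation `expand`, completeness predicate `complete`, specification `sat`, priority `u`, and
model score `M`).  The worklist is a finite multiset of partial programs (each item's
priority is given by `u`).  At each step, an item of maximal priority is dequeued; if it is
not complete, its one-step expansions are enqueued.  Assuming (i) admissibility: `M P' ≤ u P`
for every completion `P'` of `P`; (ii) `u P = M P` for complete `P`; and (iii) each enqueued
expansion `P'` of `P` satisfies `u P' ≤ u P` — in any execution starting from the root `S₀`
(with its priority), the complete programs are dequeued in non-increasing order of `M`, so
the first dequeued complete program satisfying the specification has maximal `M` among all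
dequeued complete programs satisfying the specification.
-/

/-- One step of the best-first search, with dequeued item recorded: a maximal-priority
item `P` is removed, and if `P` is not complete, a finite multiset `S` of one-step
expansions of `P` is inserted (if `P` is complete, or is discarded as infeasible, nothing is
inserted, i.e. `S` is empty). -/
inductive DequeueStep {α : Type*} (expand : α → α → Prop) (complete : α → Prop) (u : α → ℝ) :
    Multiset α → α → Multiset α → Prop
  | remove (P : α) (Q : Multiset α)
      (hmax : ∀ x ∈ P ::ₘ Q, u x ≤ u P) :
      DequeueStep expand complete u (P ::ₘ Q) P Q
  | expand (P : α) (Q S : Multiset α)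
      (hmax : ∀ x ∈ P ::ₘ Q, u x ≤ u P)
      (hnc : ¬ complete P)
      (hS : ∀ P' ∈ S, expand P P') :
      DequeueStep expand complete u (P ::ₘ Q) P (Q + S)

theorem complete_programs_dequeued_in_order {α : Type*}
    (expand : α → α → Prop) (complete sat : α → Prop) (M u : α → ℝ) (S₀ : α)
    (hadm : ∀ P P', Relation.ReflTransGen expand P P' → complete P' → M P' ≤ u P)
    (hu_complete : ∀ P, complete P → u P = M P)
    (hexp_le : ∀ P P', expand P P' → u P' ≤ u P)
    (n : ℕ) (Q : ℕ → Multiset α) (rem : ℕ → α)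
    (hinit : Q 0 = {S₀})
    (hstep : ∀ i < n, DequeueStep expand complete u (Q i) (rem i) (Q (i + 1))) :
    (∀ i j, i ≤ j → j < n → complete (rem i) → complete (rem j) →
        M (rem j) ≤ M (rem i)) ∧
    (∀ k, k < n → complete (rem k) → sat (rem k) →
        (∀ i < k, ¬ (complete (rem i) ∧ sat (rem i))) →
        ∀ j < n, complete (rem j) → sat (rem j) → M (rem j) ≤ M (rem k)) := by
  have key : ∀ i j, i ≤ j → j < n → u (rem j) ≤ u (rem i) := by
    have mem : ∀ i < n, rem i ∈ Q i := by
      intro i hi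
      have h := hstep i hi
      generalize Q i = A at h ⊢
      generalize Q (i + 1) = B at h
      generalize rem i = p at h ⊢
      cases h <;> simp
    have next : ∀ i < n, ∀ x ∈ Q (i + 1), u x ≤ u (rem i) := by
      intro i hi
      have h := hstep i hi
      generalize Q i = A at h
      generalize Q (i + 1) = B at h ⊢
      generalize rem i = p at h ⊢
      cases h with
      | remove _ _ hmax => exact fun x hx => hmax x (Multiset.mem_cons_of_mem hx)
      | expand _ R S hmax hnc hS =>
        intro x hx
        rcases Multiset.mem_add.1 hx with hx | hx
        · exact hmax x (Multiset.mem_cons_of_mem hx)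
        · exact hexp_le _ _ (hS x hx)
    intro i j hij
    induction j, hij using Nat.le_induction with
    | base => exact fun _ => le_rfl
    | succ j _ ih =>
      intro hj
      exact (next j (by omega) _ (mem (j + 1) hj)).trans (ih (by omega))
  have ord : ∀ i j, i ≤ j → j < n → complete (rem i) → complete (rem j) →
      M (rem j) ≤ M (rem i) := by
    intro i j hij hj hi hc
    rw [← hu_complete _ hi, ← hu_complete _ hc]
    exact key i j hij hj
  refine ⟨ord, ?_⟩
  intro k _ hc _ hfirst j hj hcj hsj
  refine ord k j ?_ hj hc hcj
  by_contra hlt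
  exact hfirst j (by omega) ⟨hcj, hsj⟩
end
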